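/- arXiv:1107.5884 — 3 statements merged into one kernel-verified Lean document; each statement's English description precedes it below -/
import Mathlib

section
/- Let n ≥ 1 be an integer and let α, α' ∈ ℤ³. There exists a homeomorphism ψ : T³ × T → T³ × T satisfying pr₁ ∘ ψ = pr₁ and φ_α ∘ ψ = φ_{α'} if and only if n divides α_i − α'_i for each i ∈ {1,2,3}. -/
/-- The circle `T = ℝ/ℤ`. -/
abbrev Circle' : Type := AddCircle (1 : ℝ)

/-- The 3-torus `T³ = T × T × T`. -/
abbrev Torus3 : Type := Circle' × Circle' × Circle'

/-- The fiberwise map `φ_α : T³ × T → T³ × T`,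
`φ_α(p, θ) = (p, n • θ + α₁ • p₁ + α₂ • p₂ + α₃ • p₃)`. -/
noncomputable def phiMap (n : ℤ) (α : ℤ × ℤ × ℤ) : Torus3 × Circle' → Torus3 × Circle' :=
  fun q => (q.1, n • q.2 + α.1 • q.1.1 + α.2.1 • q.1.2.1 + α.2.2 • q.1.2.2)

/-- If an `n`-th multiple of a continuous self-map of the circle is multiplication by `k`,
then `n` divides `k`. -/
theorem dvd_of_zsmul_continuous_eq_zsmul {n k : ℤ} (hn : 0 < n) {g : Circle' → Circle'}
    (hg : Continuous g) (h : ∀ t, n • g t = k • t) : n ∣ k := by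
  have hn' : (n : ℝ) ≠ 0 := by exact_mod_cast hn.ne'
  let S : Set Circle' := {u | n • u = 0}
  have hS : S.Finite := AddCircle.finite_torsion_of_isSMulRegular_int 1 n (IsSMulRegular.of_ne_zero hn.ne')
  let f : ℝ → Circle' := fun x => g (x : Circle') - ((k * x / n : ℝ) : Circle')
  have hf : Continuous f := by
    refine (hg.comp (AddCircle.continuous_mk' 1)).sub ((AddCircle.continuous_mk' 1).comp ?_)
    fun_prop
  have hfS : Set.MapsTo f Set.univ S := by
    intro x _
    change n • f x = 0
    rw [zsmul_sub, h, ← AddCircle.coe_zsmul,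
      ← AddCircle.coe_zsmul, zsmul_eq_mul, zsmul_eq_mul, mul_div_cancel₀ _ hn', sub_self]
  have : Finite S := hS
  have h01 : f 1 = f 0 :=
    isPreconnected_univ.constant_of_mapsTo (isDiscrete_iff_discreteTopology.2 inferInstance)
      hf.continuousOn hfS trivial trivial
  have hk : ((k / n : ℝ) : Circle') = 0 := by
    simpa [f, AddCircle.coe_period] using h01
  obtain ⟨m, hm⟩ := (AddCircle.coe_eq_zero_iff 1).1 hk
  refine ⟨m, ?_⟩
  rw [zsmul_one, eq_div_iff hn'] at hm
  rw [mul_comm]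
  exact_mod_cast hm.symm

/-- The fiberwise translation of `T³ × T` by the character `p ↦ ⟨β, p⟩`. -/
noncomputable def fiberTranslation (β : ℤ × ℤ × ℤ) : (Torus3 × Circle') ≃ₜ (Torus3 × Circle') where
  toFun q := (q.1, q.2 + (β.1 • q.1.1 + β.2.1 • q.1.2.1 + β.2.2 • q.1.2.2))
  invFun q := (q.1, q.2 - (β.1 • q.1.1 + β.2.1 • q.1.2.1 + β.2.2 • q.1.2.2))
  left_inv q := by simp
  right_inv q := by simp
  continuous_toFun := by fun_prop
  continuous_invFun := by fun_prop

/-- Let `n ≥ 1` and `α, α' ∈ ℤ³`. There exists a homeomorphism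
`ψ : T³ × T → T³ × T` satisfying `pr₁ ∘ ψ = pr₁` and `φ_α ∘ ψ = φ_{α'}` if and
only if `n` divides `α_i − α'_i` for each `i ∈ {1, 2, 3}`. -/
theorem stmt_3 (n : ℤ) (hn : 1 ≤ n) (α α' : ℤ × ℤ × ℤ) :
    (∃ ψ : (Torus3 × Circle') ≃ₜ (Torus3 × Circle'),
        (∀ q : Torus3 × Circle', (ψ q).1 = q.1) ∧
        phiMap n α ∘ ψ = phiMap n α') ↔
    (n ∣ α.1 - α'.1 ∧ n ∣ α.2.1 - α'.2.1 ∧ n ∣ α.2.2 - α'.2.2) := by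
  constructor
  · rintro ⟨ψ, hψ, hφ⟩
    have key (p : Torus3) : n • (ψ (p, 0)).2 =
        (α'.1 - α.1) • p.1 + (α'.2.1 - α.2.1) • p.2.1 + (α'.2.2 - α.2.2) • p.2.2 := by
      have h := congrArg Prod.snd (congrFun hφ (p, 0))
      simp only [Function.comp_apply, phiMap, hψ, smul_zero, zero_add] at h
      simp only [sub_smul]
      rw [add_assoc, add_assoc, ← eq_sub_iff_add_eq] at h
      rw [h]
      abel
    refine ⟨?_, ?_, ?_⟩ <;> rw [dvd_sub_comm]
    · refine dvd_of_zsmul_continuous_eq_zsmul hn (g := fun t => (ψ ((t, 0, 0), 0)).2)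
        (by fun_prop) fun t => ?_
      simpa using key (t, 0, 0)
    · refine dvd_of_zsmul_continuous_eq_zsmul hn (g := fun t => (ψ ((0, t, 0), 0)).2)
        (by fun_prop) fun t => ?_
      simpa using key (0, t, 0)
    · refine dvd_of_zsmul_continuous_eq_zsmul hn (g := fun t => (ψ ((0, 0, t), 0)).2)
        (by fun_prop) fun t => ?_
      simpa using key (0, 0, t)
  · rintro ⟨⟨a, ha⟩, ⟨b, hb⟩, ⟨c, hc⟩⟩
    refine ⟨(fiberTranslation (a, b, c)).symm, fun q => rfl, funext fun q => Prod.ext rfl ?_⟩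
    change n • (q.2 - (a • q.1.1 + b • q.1.2.1 + c • q.1.2.2)) + α.1 • q.1.1 + α.2.1 • q.1.2.1 +
      α.2.2 • q.1.2.2 = n • q.2 + α'.1 • q.1.1 + α'.2.1 • q.1.2.1 + α'.2.2 • q.1.2.2
    rw [sub_eq_iff_eq_add.1 ha, sub_eq_iff_eq_add.1 hb, sub_eq_iff_eq_add.1 hc]
    simp only [smul_sub, smul_add, add_smul, mul_smul]
    abel
end

section
/- Let n ≥ 1 be an integer and let α, α' ∈ ℤ³ be two integer vectors all of whose entries lie in {0, 1, ..., n−1}. If there exists a homeomorphism ψ : T³ × T → T³ × T satisfying pr₁ ∘ ψ = pr₁ and φ_α ∘ ψ = φ_{α'}, then α = α'. Consequently, the n³ fiberwise n-fold coverings φ_α with α ∈ (ℤ ∩ [0,n−1])³ are pairwise non-equivalent. -/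
/-- A continuous self-map `g` of the circle with `n • g(x) = k • x` forces `n ∣ k`. -/
theorem dvd_of_continuous_zsmul_eq {n k : ℤ} (hn : 0 < n) {g : Circle' → Circle'}
    (hg : Continuous g) (h : ∀ x, n • g x = k • x) : n ∣ k := by
  have hn0 : (n : ℝ) ≠ 0 := by exact_mod_cast hn.ne'
  let d : ℝ → Circle' := fun x => g (x : Circle') - ((k / n * x : ℝ) : Circle')
  have hd : Continuous d :=
    (hg.comp (AddCircle.continuous_mk' 1)).sub
      ((AddCircle.continuous_mk' 1).comp (continuous_const.mul continuous_id))
  have htors : Set.range d ⊆ {u : Circle' | n.natAbs • u = 0} := by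
    rintro _ ⟨x, rfl⟩
    have hx : n • d x = 0 := by
      simp only [d, smul_sub, h, ← AddCircle.coe_zsmul, zsmul_eq_mul]
      rw [sub_eq_zero]
      congr 1
      field_simp
    rwa [← Int.natAbs_of_nonneg hn.le, natCast_zsmul] at hx
  have hfin : (Set.range d).Finite :=
    (AddCircle.finite_torsion 1 (Int.natAbs_pos.mpr hn.ne')).subset htors
  have hsub : (Set.range d).Subsingleton := by
    by_contra hnt
    exact (isPreconnected_range hd).infinite_of_nontrivial
      (Set.not_subsingleton_iff.mp hnt) hfin
  have h01 : d 0 = d 1 := hsub ⟨0, rfl⟩ ⟨1, rfl⟩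
  have hper : ((1 : ℝ) : Circle') = ((0 : ℝ) : Circle') := by
    simp
  have hk : ((k / n : ℝ) : Circle') = 0 := by
    simp only [d, hper, mul_zero, mul_one, AddCircle.coe_zero, sub_zero] at h01
    exact sub_eq_self.mp h01.symm
  obtain ⟨m, hm⟩ := (AddCircle.coe_eq_zero_iff 1).mp hk
  refine ⟨m, ?_⟩
  rw [zsmul_eq_mul, mul_one, eq_div_iff hn0] at hm
  rw [mul_comm]
  exact_mod_cast hm.symm

/-- If a bundle map `ψ` satisfies `φ_α ∘ ψ = φ_{α'}`, then along every loop `c` in `T³` on which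
the two characters restrict to `a` and `a'`, the degrees `a` and `a'` agree modulo `n`. -/
theorem dvd_sub_of_phiMap_comp_eq {n : ℤ} (hn : 0 < n) {α α' : ℤ × ℤ × ℤ}
    {ψ : Torus3 × Circle' → Torus3 × Circle'} (hψ : Continuous ψ)
    (hfst : ∀ q, (ψ q).1 = q.1) (hcomp : phiMap n α ∘ ψ = phiMap n α')
    {c : Circle' → Torus3} (hc : Continuous c) {a a' : ℤ}
    (ha : ∀ x, α.1 • (c x).1 + α.2.1 • (c x).2.1 + α.2.2 • (c x).2.2 = a • x)
    (ha' : ∀ x, α'.1 • (c x).1 + α'.2.1 • (c x).2.1 + α'.2.2 • (c x).2.2 = a' • x) :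
    n ∣ a' - a := by
  refine dvd_of_continuous_zsmul_eq hn (g := fun x => (ψ (c x, 0)).2) (by fun_prop) fun x => ?_
  have hx := congrArg Prod.snd (congrFun hcomp (c x, 0))
  simp only [phiMap, Function.comp_apply, hfst, smul_zero, zero_add, add_assoc] at hx ha ha'
  rw [ha, ha'] at hx
  rw [sub_smul, ← hx, add_sub_cancel_right]

/-- Let `n ≥ 1` and let `α, α' ∈ ℤ³` have all entries in
`{0, 1, …, n − 1}`. If there exists a homeomorphism `ψ : T³ × T → T³ × T`
satisfying `pr₁ ∘ ψ = pr₁` and `φ_α ∘ ψ = φ_{α'}`, then `α = α'`. -/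
theorem stmt_4 (n : ℤ) (hn : 1 ≤ n) (α α' : ℤ × ℤ × ℤ)
    (hα : 0 ≤ α.1 ∧ α.1 ≤ n - 1 ∧ 0 ≤ α.2.1 ∧ α.2.1 ≤ n - 1 ∧
          0 ≤ α.2.2 ∧ α.2.2 ≤ n - 1)
    (hα' : 0 ≤ α'.1 ∧ α'.1 ≤ n - 1 ∧ 0 ≤ α'.2.1 ∧ α'.2.1 ≤ n - 1 ∧
           0 ≤ α'.2.2 ∧ α'.2.2 ≤ n - 1)
    (hψ : ∃ ψ : (Torus3 × Circle') ≃ₜ (Torus3 × Circle'),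
        (∀ q : Torus3 × Circle', (ψ q).1 = q.1) ∧
        phiMap n α ∘ ψ = phiMap n α') :
    α = α' := by
  obtain ⟨ψ, hfst, hcomp⟩ := hψ
  have hn0 : 0 < n := by lia
  have eq_of_dvd {a a' : ℤ} (ha : 0 ≤ a ∧ a ≤ n - 1) (ha' : 0 ≤ a' ∧ a' ≤ n - 1)
      (h : n ∣ a' - a) : a = a' := by
    have := Int.eq_zero_of_abs_lt_dvd h (abs_lt.mpr ⟨by lia, by lia⟩)
    lia
  obtain ⟨h1, h1', h2, h2', h3, h3'⟩ := hα
  obtain ⟨k1, k1', k2, k2', k3, k3'⟩ := hα'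
  refine Prod.ext (eq_of_dvd ⟨h1, h1'⟩ ⟨k1, k1'⟩ ?_)
    (Prod.ext (eq_of_dvd ⟨h2, h2'⟩ ⟨k2, k2'⟩ ?_) (eq_of_dvd ⟨h3, h3'⟩ ⟨k3, k3'⟩ ?_))
  · exact dvd_sub_of_phiMap_comp_eq hn0 ψ.continuous hfst hcomp
      (c := fun x => (x, 0, 0)) (by fun_prop) (by simp) (by simp)
  · exact dvd_sub_of_phiMap_comp_eq hn0 ψ.continuous hfst hcomp
      (c := fun x => (0, x, 0)) (by fun_prop) (by simp) (by simp)
  · exact dvd_sub_of_phiMap_comp_eq hn0 ψ.continuous hfst hcomp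
      (c := fun x => (0, 0, x)) (by fun_prop) (by simp) (by simp)
end

section
/- Let X be a topological space, let n ≥ 1 be an integer, and let φ : X × T → X × T be a continuous map with pr₁ ∘ φ = pr₁ such that for every p ∈ X the fiber map θ ↦ pr₂(φ(p,θ)) from T to T has degree n. Let c : T → X be a continuous loop and let s, s' : T → T be continuous maps, so that (c,s) and (c,s') are two continuous lifts of c to X × T. If d is the degree of the map θ ↦ pr₂(φ(c(θ), s(θ))) and d' is the degree of the map θ ↦ pr₂(φ(c(θ), s'(θ))), then d ≡ d' (mod n). In other words, the degree of pr₂ ∘ φ ∘ c̃ modulo n does not depend on the chosen lift c̃ of the loop c, so the class α associated to a fiberwise n-fold covering is well defined. -/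
/-- A continuous map `f : T → T` has degree `d ∈ ℤ` if there exists a
continuous `F : ℝ → ℝ` with `f (x mod 1) = F x mod 1` for all `x ∈ ℝ` and
`F (x + 1) = F x + d` for all `x ∈ ℝ`. -/
def HasDegree (f : Circle' → Circle') (d : ℤ) : Prop :=
  ∃ F : ℝ → ℝ, Continuous F ∧
    (∀ x : ℝ, f ((x : ℝ) : Circle') = ((F x : ℝ) : Circle')) ∧
    ∀ x : ℝ, F (x + 1) = F x + (d : ℝ)

/-- Two continuous real lifts of the same circle-valued map on a connected space differ by an
integer constant. -/
theorem exists_int_forall_eq_add_of_coe_eq {A : Type*} [TopologicalSpace A] [PreconnectedSpace A]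
    [Nonempty A] {F G : A → ℝ} (hF : Continuous F) (hG : Continuous G)
    (h : ∀ a, (F a : Circle') = (G a : Circle')) : ∃ k : ℤ, ∀ a, F a = G a + k := by
  obtain ⟨a₀⟩ := ‹Nonempty A›
  obtain ⟨k, hk⟩ := AddCircle.coe_eq_zero_iff (1 : ℝ) |>.1
    (show ((F a₀ - G a₀ : ℝ) : Circle') = 0 by rw [AddCircle.coe_sub, h, sub_self])
  rw [zsmul_one] at hk
  have hk₀ : ((k : ℝ) : Circle') = 0 := (AddCircle.coe_eq_zero_iff 1).2 ⟨k, zsmul_one k⟩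
  exact ⟨k, congrFun <| (AddCircle.isCoveringMap_coe (1 : ℝ)).eq_of_comp_eq hF
    (hG.add continuous_const)
    (funext fun a => by
      simp only [Function.comp_apply, AddCircle.coe_add, h, hk₀, add_zero])
    a₀ (by rw [hk]; ring)⟩

/-- A continuous circle-valued map on a simply connected, locally path connected space lifts
to `ℝ`. -/
theorem exists_continuous_real_lift {A : Type*} [TopologicalSpace A] [SimplyConnectedSpace A]
    [LocallyPathConnectedSpace A] {f : A → Circle'} (hf : Continuous f) :
    ∃ F : A → ℝ, Continuous F ∧ ∀ a, (F a : Circle') = f a := by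
  obtain ⟨a₀⟩ : Nonempty A := inferInstance
  obtain ⟨y, hy⟩ := QuotientAddGroup.mk_surjective (f a₀)
  obtain ⟨F, ⟨-, hF⟩, -⟩ := (AddCircle.isCoveringMap_coe (1 : ℝ)).existsUnique_continuousMap_lifts
    ⟨f, hf⟩ a₀ y hy
  exact ⟨F, F.continuous, congrFun hF⟩

/-- A real lift of a map of degree `d` along `ℝ → T` increases by `d` over each period. -/
theorem HasDegree.lift_add_one {f : Circle' → Circle'} {d : ℤ} (hf : HasDegree f d) {G : ℝ → ℝ}
    (hG : Continuous G) (h : ∀ x : ℝ, (G x : Circle') = f (x : Circle')) (x : ℝ) :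
    G (x + 1) = G x + d := by
  obtain ⟨F, hFc, hF, hFd⟩ := hf
  obtain ⟨k, hk⟩ := exists_int_forall_eq_add_of_coe_eq hG hFc fun y => (h y).trans (hF y)
  rw [hk, hk, hFd]
  ring

/-- Every continuous self-map of the circle has a degree. -/
theorem exists_hasDegree {f : Circle' → Circle'} (hf : Continuous f) : ∃ d, HasDegree f d := by
  obtain ⟨F, hFc, hF⟩ := exists_continuous_real_lift (f := fun x : ℝ => f (x : Circle'))
    (hf.comp (AddCircle.continuous_mk' (1 : ℝ)))
  obtain ⟨d, hd⟩ := exists_int_forall_eq_add_of_coe_eq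
    (F := fun x => F (x + 1)) (by fun_prop) hFc (fun x => by
      simp only [hF, AddCircle.coe_add_period])
  exact ⟨d, F, hFc, fun x => (hF x).symm, hd⟩

/-- If `G : ℝ × ℝ → ℝ` lifts a circle-valued map `g` on the torus and has increments `m` and `n`
in the two variables, then the degree of `g` along the graph of any continuous `s` is congruent to
`m` modulo `n`. -/
theorem HasDegree.modEq_of_torus_lift {g : Circle' → Circle' → Circle'} {m n d : ℤ}
    {G : ℝ × ℝ → ℝ} (hGc : Continuous G)
    (hG : ∀ x y : ℝ, (G (x, y) : Circle') = g (x : Circle') (y : Circle'))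
    (hm : ∀ x y, G (x + 1, y) = G (x, y) + m) (hn : ∀ x y, G (x, y + 1) = G (x, y) + n)
    {s : Circle' → Circle'} (hs : Continuous s) (hd : HasDegree (fun θ => g θ (s θ)) d) :
    d ≡ m [ZMOD n] := by
  obtain ⟨k, S, hSc, hS, hSk⟩ := exists_hasDegree hs
  have hnk (x y : ℝ) : G (x, y + k) = G (x, y) + k * n := by
    have hper : Function.Periodic (fun z : ℝ => G (x, z) - n * z) 1 := fun z => by
      simp only [hn]
      ring
    have := hper.int_mul k y
    simp only [mul_one] at this
    linarith
  have hinc := hd.lift_add_one (G := fun x => G (x, S x)) (by fun_prop)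
    (fun x => by rw [hG, hS]) 0
  simp only [hSk, hnk, hm] at hinc
  have hdm : d = m + k * n := by
    have : (d : ℝ) = m + k * n := by linarith
    exact_mod_cast this
  rw [hdm]
  exact Int.modEq_iff_dvd.2 ⟨-k, by ring⟩

/-- Let `X` be a topological space, `n ≥ 1` an integer, and
`φ : X × T → X × T` a continuous map with `pr₁ ∘ φ = pr₁` such that for every
`p ∈ X` the fiber map `θ ↦ pr₂(φ(p, θ))` has degree `n`.  Let `c : T → X` be a
continuous loop and `s, s' : T → T` continuous maps, so that `(c, s)` and
`(c, s')` are two continuous lifts of `c` to `X × T`.  If `d` is the degree of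
`θ ↦ pr₂(φ(c θ, s θ))` and `d'` is the degree of `θ ↦ pr₂(φ(c θ, s' θ))`,
then `d ≡ d' (mod n)`. -/
theorem stmt_6 (X : Type*) [TopologicalSpace X] (n : ℤ) (hn : 1 ≤ n)
    (φ : X × Circle' → X × Circle') (hφ : Continuous φ)
    (hfst : ∀ q : X × Circle', (φ q).1 = q.1)
    (hfib : ∀ p : X, HasDegree (fun θ => (φ (p, θ)).2) n)
    (c : Circle' → X) (hc : Continuous c)
    (s s' : Circle' → Circle') (hs : Continuous s) (hs' : Continuous s')
    (d d' : ℤ)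
    (hd : HasDegree (fun θ => (φ (c θ, s θ)).2) d)
    (hd' : HasDegree (fun θ => (φ (c θ, s' θ)).2) d') :
    d ≡ d' [ZMOD n] := by
  have hgc : Continuous fun q : ℝ × ℝ => (φ (c (q.1 : Circle'), (q.2 : Circle'))).2 := by
    have hq := AddCircle.continuous_mk' (1 : ℝ)
    exact continuous_snd.comp (hφ.comp ((hc.comp (hq.comp continuous_fst)).prodMk
      (hq.comp continuous_snd)))
  obtain ⟨G, hGc, hG⟩ := exists_continuous_real_lift hgc
  obtain ⟨m, hm⟩ := exists_int_forall_eq_add_of_coe_eq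
    (F := fun q : ℝ × ℝ => G (q.1 + 1, q.2)) (by fun_prop) hGc (fun q => by
      simp only [hG, AddCircle.coe_add_period])
  have hn' (x y : ℝ) : G (x, y + 1) = G (x, y) + n :=
    (hfib (c x)).lift_add_one (G := fun y => G (x, y)) (by fun_prop) (fun y => hG (x, y)) y
  have key {t : Circle' → Circle'} (ht : Continuous t) {e : ℤ}
      (he : HasDegree (fun θ => (φ (c θ, t θ)).2) e) : e ≡ m [ZMOD n] :=
    HasDegree.modEq_of_torus_lift (g := fun θ η => (φ (c θ, η)).2) hGc (fun x y => hG (x, y))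
      (fun x y => hm (x, y)) hn' ht he
  exact (key hs hd).trans (key hs' hd').symm
end
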